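/- arXiv:1510.08093 — 4 statements merged into one kernel-verified Lean document; each statement's English description precedes it below -/
import Mathlib

section
/- Let ε > 0, let I ⊆ ℝ be an open interval, let η : ℝ² → ℝ be a C¹ function with η > 0 everywhere, and let w : ℝ² × I → ℂ be a C² function satisfying the weighted Gross–Pitaevskii equation i η² ∂ₜw = div(η² ∇w) + (η⁴/ε²)(1 − |w|²)w pointwise on ℝ² × I. Then at every point of ℝ² × I one has the energy conservation identity ∂ₜ e^η_ε(w) = div( η² (∇w, ∂ₜw) ), where (∇w, ∂ₜw) is the vector field with components Re(∂_k w · conj(∂ₜw)), k = 1,2, and div denotes the spatial divergence. -/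
open MeasureTheory Real

/-- Partial derivative in the `k`-th coordinate direction of `ℝ²`. -/
noncomputable def pd {E : Type*} [NormedAddCommGroup E] [NormedSpace ℝ E] (k : Fin 2)
    (f : EuclideanSpace ℝ (Fin 2) → E) (x : EuclideanSpace ℝ (Fin 2)) : E :=
  fderiv ℝ f x (EuclideanSpace.single k 1)

/-- Weighted Ginzburg–Landau energy density
`e^η_ε(w) = (η²/2)(|∂₁w|² + |∂₂w|²) + (η⁴/(4ε²))(1 − |w|²)²`. -/
noncomputable def eden (ε : ℝ) (η : EuclideanSpace ℝ (Fin 2) → ℝ)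
    (w : EuclideanSpace ℝ (Fin 2) → ℂ) (x : EuclideanSpace ℝ (Fin 2)) : ℝ :=
  (η x)^2 / 2 * (‖pd 0 w x‖^2 + ‖pd 1 w x‖^2) + (η x)^4 / (4 * ε^2) * (1 - ‖w x‖^2)^2

/-- The spatial partial derivative of a time slice, read off from the full derivative. -/
lemma pd_slice {w : EuclideanSpace ℝ (Fin 2) × ℝ → ℂ} {y : EuclideanSpace ℝ (Fin 2)} {t : ℝ}
    (k : Fin 2) (h : DifferentiableAt ℝ w (y, t)) :
    pd k (fun z => w (z, t)) y = fderiv ℝ w (y, t) (EuclideanSpace.single k 1, 0) := by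
  have h1 : HasFDerivAt (fun z => w (z, t)) _ y :=
    h.hasFDerivAt.comp y (hasFDerivAt_prodMk_left (𝕜 := ℝ) y t)
  rw [pd, h1.fderiv]
  simp

/-- The time derivative at a fixed point of space, read off from the full derivative. -/
lemma deriv_slice {E F : Type*} [NormedAddCommGroup E] [NormedSpace ℝ E]
    [NormedAddCommGroup F] [NormedSpace ℝ F] {w : E × ℝ → F} {y : E} {t : ℝ}
    (h : DifferentiableAt ℝ w (y, t)) :
    HasDerivAt (fun s => w (y, s)) (fderiv ℝ w (y, t) (0, 1)) t :=
  h.hasFDerivAt.comp_hasDerivAt t ((hasDerivAt_const t y).prodMk (hasDerivAt_id t))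

/-- Leibniz rule for the partial derivative of the real scalar product `Re (f conj g)`. -/
lemma pd_re_mul_conj {f g : EuclideanSpace ℝ (Fin 2) → ℂ} {x : EuclideanSpace ℝ (Fin 2)}
    (k : Fin 2) (hf : DifferentiableAt ℝ f x) (hg : DifferentiableAt ℝ g x) :
    pd k (fun y => (f y * (starRingEnd ℂ) (g y)).re) x
      = (pd k f x * (starRingEnd ℂ) (g x)).re + (f x * (starRingEnd ℂ) (pd k g x)).re := by
  have h := hg.hasFDerivAt.inner ℝ hf.hasFDerivAt
  have he : (fun y => (f y * (starRingEnd ℂ) (g y)).re) = fun y => inner ℝ (g y) (f y) := by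
    funext y
    rw [Complex.inner]
  rw [he, pd, h.fderiv]
  simp [pd, Complex.inner]

/-- energy conservation for the weighted Gross–Pitaevskii equation
`i η² ∂ₜ w = div(η² ∇w) + (η⁴/ε²)(1 − |w|²) w`:
at every point, `∂ₜ e^η_ε(w) = div(η² (∇w, ∂ₜw))` where `(∇w, ∂ₜw)_k = Re(∂_k w ⬝ conj ∂ₜ w)`. -/
theorem energy_conservation
    (ε : ℝ) (hε : 0 < ε) (I : Set ℝ) (hIopen : IsOpen I) (hIconn : I.OrdConnected)
    (η : EuclideanSpace ℝ (Fin 2) → ℝ) (hη : ContDiff ℝ 1 η) (hηpos : ∀ x, 0 < η x)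
    (w : EuclideanSpace ℝ (Fin 2) × ℝ → ℂ)
    (hw : ContDiffOn ℝ 2 w (Set.univ ×ˢ I))
    (hGP : ∀ x : EuclideanSpace ℝ (Fin 2), ∀ t ∈ I,
      Complex.I * ((η x : ℂ))^2 * deriv (fun s => w (x, s)) t
        = (∑ k : Fin 2, pd k (fun y => ((η y : ℂ))^2 * pd k (fun z => w (z, t)) y) x)
          + ((η x : ℂ))^4 / (ε : ℂ)^2 * ((1 : ℂ) - ((‖w (x, t)‖ : ℝ) : ℂ)^2) * w (x, t)) :
    ∀ x : EuclideanSpace ℝ (Fin 2), ∀ t ∈ I,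
      deriv (fun s => eden ε η (fun y => w (y, s)) x) t
        = ∑ k : Fin 2, pd k
            (fun y => (η y)^2 *
              (pd k (fun z => w (z, t)) y *
                (starRingEnd ℂ) (deriv (fun s => w (y, s)) t)).re) x := by
  intro x t ht
  have hU : IsOpen ((Set.univ : Set (EuclideanSpace ℝ (Fin 2))) ×ˢ I) := isOpen_univ.prod hIopen
  have hC : ∀ y, ∀ s ∈ I, ContDiffAt ℝ 2 w (y, s) := fun y s hs =>
    hw.contDiffAt (hU.mem_nhds ⟨Set.mem_univ y, hs⟩)
  have hd : ∀ y, ∀ s ∈ I, DifferentiableAt ℝ w (y, s) := fun y s hs =>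
    (hC y s hs).differentiableAt (by norm_num)
  have hD : DifferentiableAt ℝ (fderiv ℝ w) (x, t) :=
    ((hC x t ht).fderiv_right (m := 1) (by norm_num)).differentiableAt (by norm_num)
  have hsymm : IsSymmSndFDerivAt ℝ w (x, t) :=
    (hC x t ht).isSymmSndFDerivAt (by simp)
  set b : ℂ := fderiv ℝ w (x, t) (0, 1) with hb
  set H := fderiv ℝ (fderiv ℝ w) (x, t) with hH
  have hdt : ∀ y, deriv (fun s => w (y, s)) t = fderiv ℝ w (y, t) (0, 1) := fun y =>
    (deriv_slice (hd y t ht)).deriv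
  have hpd : ∀ k, pd k (fun z => w (z, t))
      = fun y => fderiv ℝ w (y, t) (EuclideanSpace.single k 1, 0) := fun k =>
    funext fun y => pd_slice k (hd y t ht)
  -- spatial derivative of the full derivative applied to a fixed vector
  have hspace : ∀ v, HasFDerivAt (fun y => fderiv ℝ w (y, t) v)
      ((ContinuousLinearMap.apply ℝ ℂ v).comp
        (H.comp (ContinuousLinearMap.inl ℝ (EuclideanSpace ℝ (Fin 2)) ℝ))) x := fun v =>
    (ContinuousLinearMap.apply ℝ ℂ v).hasFDerivAt.comp x
      (hD.hasFDerivAt.comp x (hasFDerivAt_prodMk_left (𝕜 := ℝ) x t))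
  have hmixed : ∀ k, pd k (fun y => fderiv ℝ w (y, t) (0, 1)) x
      = H (0, 1) (EuclideanSpace.single k 1, 0) := by
    intro k
    rw [pd, (hspace (0, 1)).fderiv, hsymm.eq]
    simp [hH]
  have htime : ∀ k, HasDerivAt (fun s => pd k (fun z => w (z, s)) x)
      (H (0, 1) (EuclideanSpace.single k 1, 0)) t := by
    intro k
    have h := (ContinuousLinearMap.apply ℝ ℂ
      ((EuclideanSpace.single k 1, 0) : EuclideanSpace ℝ (Fin 2) × ℝ)).hasFDerivAt.comp_hasDerivAt
        t (deriv_slice hD)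
    refine h.congr_of_eventuallyEq ?_
    filter_upwards [hIopen.mem_nhds ht] with s hs
    exact pd_slice k (hd x s hs)
  have hw_t : HasDerivAt (fun s => w (x, s)) b t := deriv_slice (hd x t ht)
  have hflux : ∀ k, pd k (fun y => (η y)^2 * (pd k (fun z => w (z, t)) y *
        (starRingEnd ℂ) (deriv (fun s => w (y, s)) t)).re) x
      = (pd k (fun y => ((η y : ℂ))^2 * pd k (fun z => w (z, t)) y) x * (starRingEnd ℂ) b).re
        + (η x)^2 * (pd k (fun z => w (z, t)) x *
          (starRingEnd ℂ) (H (0, 1) (EuclideanSpace.single k 1, 0))).re := by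
    intro k
    have hηd : DifferentiableAt ℝ (fun y => ((η y : ℂ))^2) x :=
      (Complex.ofRealCLM.differentiableAt.comp x
        (hη.differentiable (by norm_num) x)).pow 2
    have hF : DifferentiableAt ℝ (fun y => ((η y : ℂ))^2 * pd k (fun z => w (z, t)) y) x := by
      refine hηd.mul ?_
      rw [hpd k]
      exact (hspace _).differentiableAt
    have h := pd_re_mul_conj k hF (hspace (0, 1)).differentiableAt
    rw [hmixed k] at h
    have hre : ∀ (r : ℝ) (z u : ℂ), ((r : ℂ)^2 * z * u).re = r^2 * (z * u).re := by
      intro r z u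
      rw [mul_assoc, ← Complex.ofReal_pow, Complex.re_ofReal_mul]
    simp only [hre] at h
    simp only [hdt]
    exact h
  have hE := ((((htime 0).norm_sq.add (htime 1).norm_sq).const_mul ((η x)^2 / 2)).add
    (((hw_t.norm_sq.const_sub 1).pow 2).const_mul ((η x)^4 / (4 * ε^2)))).deriv
  have hE' := (show deriv (fun s => eden ε η (fun y => w (y, s)) x) t = _ from hE)
  rw [hE']
  simp only [hflux, Fin.sum_univ_two]
  have hG := hGP x t ht
  rw [hdt x, ← hb, Fin.sum_univ_two] at hG
  generalize pd 0 (fun y => ((η y : ℂ))^2 * pd 0 (fun z => w (z, t)) y) x = P at hG ⊢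
  generalize pd 1 (fun y => ((η y : ℂ))^2 * pd 1 (fun z => w (z, t)) y) x = Q at hG ⊢
  have hpot : (P * (starRingEnd ℂ) b).re + (Q * (starRingEnd ℂ) b).re
      = -((η x)^4 / ε^2 * (1 - ‖w (x, t)‖^2) * (w (x, t) * (starRingEnd ℂ) b).re) := by
    have hPQ : P + Q = Complex.I * ((η x : ℂ))^2 * b
        - (((η x)^4 / ε^2 * (1 - ‖w (x, t)‖^2) : ℝ) : ℂ) * w (x, t) := by
      push_cast
      rw [hG]
      ring
    rw [← Complex.add_re, ← add_mul, hPQ, sub_mul, Complex.sub_re, mul_assoc (Complex.ofReal _),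
      Complex.re_ofReal_mul, mul_assoc, Complex.mul_conj, ← Complex.ofReal_pow, mul_assoc,
      ← Complex.ofReal_mul, Complex.re_mul_ofReal]
    simp
  have hinner : ∀ z u : ℂ, inner ℝ z u = (z * (starRingEnd ℂ) u).re := by
    intro z u
    rw [real_inner_comm, Complex.inner]
  simp only [hinner]
  linear_combination -hpot
end

section
/- Let ε > 0, let I ⊆ ℝ be an open interval, let η : ℝ² → ℝ be a C² function with η > 0 everywhere, and let w : ℝ² × I → ℂ be a C³ function satisfying the weighted Gross–Pitaevskii equation i η² ∂ₜw = div(η² ∇w) + (η⁴/ε²)(1 − |w|²)w pointwise on ℝ² × I. Then for every C² function φ : ℝ² → ℝ with compact support and every t ∈ I, ∫_{ℝ²} φ ∂ₜJ(w) dx = ∫_{ℝ²} Σ_{ℓ,j,k} 𝕁_{ℓj} ∂_j∂_k φ · Re(∂_k w conj(∂_ℓ w)) dx − ∫_{ℝ²} Σ_{ℓ,j,k} 𝕁_{ℓj} ∂_j φ · (∂_k(η²)/η²) Re(∂_ℓ w conj(∂_k w)) dx − ∫_{ℝ²} Σ_{ℓ,j} 𝕁_{ℓj} ∂_j φ ·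 ∂_ℓ(η²) (1 − |w|²)²/(4ε²) dx, where all indices range over {1,2} and all integrands are evaluated at time t. -/
open MeasureTheory Real

/-- Jacobian `J(w) = Im(conj(∂₁w) ∂₂w)`. -/
noncomputable def jac (w : EuclideanSpace ℝ (Fin 2) → ℂ)
    (x : EuclideanSpace ℝ (Fin 2)) : ℝ :=
  ((starRingEnd ℂ) (pd 0 w x) * pd 1 w x).im

/-- The matrix `𝕁` with `𝕁₂₁ = −𝕁₁₂ = 1`, `𝕁₁₁ = 𝕁₂₂ = 0`. -/
def Jmat : Fin 2 → Fin 2 → ℝ := ![![0, -1], ![1, 0]]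

section PartialDerivatives

variable {E : Type*} [NormedAddCommGroup E] [NormedSpace ℝ E]

lemma contDiff_pd {f : EuclideanSpace ℝ (Fin 2) → E} {m n : ℕ∞} (hf : ContDiff ℝ n f)
    (hmn : m + 1 ≤ n) (k : Fin 2) : ContDiff ℝ m (pd k f) :=
  (hf.fderiv_right (by exact_mod_cast hmn)).clm_apply contDiff_const

lemma pd_add {f g : EuclideanSpace ℝ (Fin 2) → E} (hf : Differentiable ℝ f)
    (hg : Differentiable ℝ g) (k : Fin 2) (x : EuclideanSpace ℝ (Fin 2)) :
    pd k (fun y => f y + g y) x = pd k f x + pd k g x := by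
  simp [pd, fderiv_fun_add (hf x) (hg x)]

lemma pd_sub {f g : EuclideanSpace ℝ (Fin 2) → E} (hf : Differentiable ℝ f)
    (hg : Differentiable ℝ g) (k : Fin 2) (x : EuclideanSpace ℝ (Fin 2)) :
    pd k (fun y => f y - g y) x = pd k f x - pd k g x := by
  simp [pd, fderiv_fun_sub (hf x) (hg x)]

lemma pd_mul {f g : EuclideanSpace ℝ (Fin 2) → ℝ} (hf : Differentiable ℝ f)
    (hg : Differentiable ℝ g) (k : Fin 2) (x : EuclideanSpace ℝ (Fin 2)) :
    pd k (fun y => f y * g y) x = pd k f x * g x + f x * pd k g x := by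
  simp [pd, fderiv_fun_mul (hf x) (hg x)]
  ring

lemma pd_const (c : E) (k : Fin 2) (x : EuclideanSpace ℝ (Fin 2)) :
    pd k (fun _ => c) x = 0 := by
  simp [pd]

lemma pd_clm_comp {F : Type*} [NormedAddCommGroup F] [NormedSpace ℝ F] (L : E →L[ℝ] F)
    {f : EuclideanSpace ℝ (Fin 2) → E} {x : EuclideanSpace ℝ (Fin 2)}
    (hf : DifferentiableAt ℝ f x) (k : Fin 2) :
    pd k (fun y => L (f y)) x = L (pd k f x) := by
  have h := (L.hasFDerivAt.comp x hf.hasFDerivAt).fderiv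
  simp only [pd]
  change fderiv ℝ (L ∘ f) x _ = _
  rw [h]
  rfl

lemma pd_comm {f : EuclideanSpace ℝ (Fin 2) → E} (hf : ContDiff ℝ 2 f) (j k : Fin 2)
    (x : EuclideanSpace ℝ (Fin 2)) : pd j (pd k f) x = pd k (pd j f) x := by
  have hd : DifferentiableAt ℝ (fderiv ℝ f) x :=
    (hf.fderiv_right (m := 1) (by norm_num)).differentiable (by norm_num) x
  have key : ∀ i l : Fin 2, pd i (pd l f) x =
      fderiv ℝ (fderiv ℝ f) x (EuclideanSpace.single i 1) (EuclideanSpace.single l 1) :=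
    fun i l => pd_clm_comp (ContinuousLinearMap.apply ℝ E (EuclideanSpace.single l (1 : ℝ))) hd i
  rw [key, key]
  exact hf.contDiffAt.isSymmSndFDerivAt (by simp) _ _

lemma integral_pd_eq_zero {f : EuclideanSpace ℝ (Fin 2) → ℝ} (hf : ContDiff ℝ 1 f)
    (hfs : HasCompactSupport f) (k : Fin 2) : ∫ x, pd k f x = 0 := by
  have hint : Integrable (pd k f) :=
    (contDiff_pd (m := 0) (n := 1) hf (by norm_num) k).continuous.integrable_of_hasCompactSupport
      (hfs.fderiv_apply (𝕜 := ℝ) _)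
  have := integral_mul_fderiv_eq_neg_fderiv_mul_of_integrable
    (μ := (volume : Measure (EuclideanSpace ℝ (Fin 2))))
    (f := fun _ : EuclideanSpace ℝ (Fin 2) => (1 : ℝ)) (g := f)
    (v := EuclideanSpace.single k 1) (by simp) (by simp only [one_mul]; exact hint)
    (by simpa using hf.continuous.integrable_of_hasCompactSupport hfs)
    (fun _ _ => differentiableAt_const _) (fun x _ => hf.differentiable (by norm_num) x)
  simpa [pd] using this

end PartialDerivatives

/-- The weak Jacobian evolution in terms of the real and imaginary parts `a`, `b` of the wave
function and `c`, `d` of its time derivative, with squared weight `ρ`. -/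
lemma jacobian_evolution_weak_real {ε : ℝ} {a b c d ρ φ : EuclideanSpace ℝ (Fin 2) → ℝ}
    (ha : ContDiff ℝ 2 a) (hb : ContDiff ℝ 2 b) (hc : ContDiff ℝ 1 c) (hd : ContDiff ℝ 1 d)
    (hρ : ContDiff ℝ 1 ρ) (hρ0 : ∀ x, ρ x ≠ 0) (hφ : ContDiff ℝ 2 φ) (hφs : HasCompactSupport φ)
    (hre : ∀ x, -(ρ x * d x) = (∑ k : Fin 2, (pd k ρ x * pd k a x + ρ x * pd k (pd k a) x))
      + ρ x ^ 2 / ε ^ 2 * (1 - (a x ^ 2 + b x ^ 2)) * a x)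
    (him : ∀ x, ρ x * c x = (∑ k : Fin 2, (pd k ρ x * pd k b x + ρ x * pd k (pd k b) x))
      + ρ x ^ 2 / ε ^ 2 * (1 - (a x ^ 2 + b x ^ 2)) * b x) :
    ∫ x, φ x * (pd 0 c x * pd 1 b x - pd 0 d x * pd 1 a x
        + (pd 0 a x * pd 1 d x - pd 0 b x * pd 1 c x))
      = (∫ x, ∑ ℓ : Fin 2, ∑ j : Fin 2, ∑ k : Fin 2,
            Jmat ℓ j * pd j (pd k φ) x * (pd k a x * pd ℓ a x + pd k b x * pd ℓ b x))
        - (∫ x, ∑ ℓ : Fin 2, ∑ j : Fin 2, ∑ k : Fin 2,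
            Jmat ℓ j * pd j φ x * (pd k ρ x / ρ x) * (pd ℓ a x * pd k a x + pd ℓ b x * pd k b x))
        - (∫ x, ∑ ℓ : Fin 2, ∑ j : Fin 2,
            Jmat ℓ j * pd j φ x * pd ℓ ρ x * (1 - (a x ^ 2 + b x ^ 2)) ^ 2 / (4 * ε ^ 2)) := by
  have hpa k : ContDiff ℝ 1 (pd k a) := contDiff_pd (n := 2) ha (by norm_num) k
  have hpb k : ContDiff ℝ 1 (pd k b) := contDiff_pd (n := 2) hb (by norm_num) k
  have hpφ k : ContDiff ℝ 1 (pd k φ) := contDiff_pd (n := 2) hφ (by norm_num) k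
  have cpρ k : Continuous (pd k ρ) := (contDiff_pd (m := 0) (n := 1) hρ (by norm_num) k).continuous
  have cppφ j k : Continuous (pd j (pd k φ)) :=
    (contDiff_pd (m := 0) (n := 1) (hpφ k) (by norm_num) j).continuous
  have cpa k := (hpa k).continuous
  have cpb k := (hpb k).continuous
  have cpφ k := (hpφ k).continuous
  have ca := ha.continuous
  have cb := hb.continuous
  have cρ := hρ.continuous
  have z0 {x} (hx : x ∉ tsupport φ) : φ x = 0 := image_eq_zero_of_notMem_tsupport hx
  have sφ k : tsupport (pd k φ) ⊆ tsupport φ := tsupport_fderiv_apply_subset ℝ _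
  have z1 {x} (hx : x ∉ tsupport φ) (k) : pd k φ x = 0 :=
    image_eq_zero_of_notMem_tsupport fun h => hx (sφ k h)
  have z2 {x} (hx : x ∉ tsupport φ) (j k) : pd j (pd k φ) x = 0 :=
    image_eq_zero_of_notMem_tsupport fun h => hx (sφ k (tsupport_fderiv_apply_subset ℝ _ h))
  have integ {f : EuclideanSpace ℝ (Fin 2) → ℝ} (hf : Continuous f)
      (h0 : ∀ x, x ∉ tsupport φ → f x = 0) : Integrable f :=
    hf.integrable_of_hasCompactSupport (HasCompactSupport.intro hφs h0)
  have i1 : Integrable fun x => ∑ ℓ : Fin 2, ∑ j : Fin 2, ∑ k : Fin 2,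
      Jmat ℓ j * pd j (pd k φ) x * (pd k a x * pd ℓ a x + pd k b x * pd ℓ b x) :=
    integ (by fun_prop) fun x hx => by simp [z2 hx]
  have i2 : Integrable fun x => ∑ ℓ : Fin 2, ∑ j : Fin 2, ∑ k : Fin 2,
      Jmat ℓ j * pd j φ x * (pd k ρ x / ρ x) * (pd ℓ a x * pd k a x + pd ℓ b x * pd k b x) :=
    integ (by fun_prop (disch := assumption)) fun x hx => by simp [z1 hx]
  have i3 : Integrable fun x => ∑ ℓ : Fin 2, ∑ j : Fin 2,
      Jmat ℓ j * pd j φ x * pd ℓ ρ x * (1 - (a x ^ 2 + b x ^ 2)) ^ 2 / (4 * ε ^ 2) :=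
    integ (by fun_prop) fun x hx => by simp [z1 hx]
  let T k ℓ x := pd k a x * pd ℓ a x + pd k b x * pd ℓ b x
  let P ℓ x := c x * pd ℓ b x - d x * pd ℓ a x
  let q x := 1 - (a x * a x + b x * b x)
  let W x := 2⁻¹ * (T 0 0 x + T 1 1 x) + (4 * ε ^ 2)⁻¹ * (ρ x * (q x * q x))
  let G₀ x := φ x * P 1 x - (pd 0 φ x * T 0 1 x - pd 1 φ x * T 0 0 x) - pd 1 φ x * W x
  let G₁ x := pd 0 φ x * W x - (pd 0 φ x * T 1 1 x - pd 1 φ x * T 1 0 x) - φ x * P 0 x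
  have ha1 : ContDiff ℝ 1 a := ha.of_le (by norm_num)
  have hb1 : ContDiff ℝ 1 b := hb.of_le (by norm_num)
  have hφ1 : ContDiff ℝ 1 φ := hφ.of_le (by norm_num)
  have hT k ℓ : ContDiff ℝ 1 (T k ℓ) := by fun_prop
  have hP ℓ : ContDiff ℝ 1 (P ℓ) := by fun_prop
  have hq : ContDiff ℝ 1 q := by fun_prop
  have hW : ContDiff ℝ 1 W := by fun_prop
  have hG₀ : ContDiff ℝ 1 G₀ := by fun_prop
  have hG₁ : ContDiff ℝ 1 G₁ := by fun_prop
  have sG₀ : HasCompactSupport G₀ :=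
    HasCompactSupport.intro hφs fun x hx => by simp [G₀, z0 hx, z1 hx]
  have sG₁ : HasCompactSupport G₁ :=
    HasCompactSupport.intro hφs fun x hx => by simp [G₁, z0 hx, z1 hx]
  have iG₀ : Integrable (pd 0 G₀) :=
    (contDiff_pd (m := 0) (n := 1) hG₀ (by norm_num) 0).continuous.integrable_of_hasCompactSupport
      (sG₀.fderiv_apply (𝕜 := ℝ) _)
  have iG₁ : Integrable (pd 1 G₁) :=
    (contDiff_pd (m := 0) (n := 1) hG₁ (by norm_num) 1).continuous.integrable_of_hasCompactSupport
      (sG₁.fderiv_apply (𝕜 := ℝ) _)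
  have da := ha1.differentiable one_ne_zero
  have db := hb1.differentiable one_ne_zero
  have dc := hc.differentiable one_ne_zero
  have dd := hd.differentiable one_ne_zero
  have dρ := hρ.differentiable one_ne_zero
  have dφ := hφ1.differentiable one_ne_zero
  have dpa k := (hpa k).differentiable one_ne_zero
  have dpb k := (hpb k).differentiable one_ne_zero
  have dpφ k := (hpφ k).differentiable one_ne_zero
  have dT k ℓ := (hT k ℓ).differentiable one_ne_zero
  have dP ℓ := (hP ℓ).differentiable one_ne_zero
  have dq := hq.differentiable one_ne_zero
  have dW := hW.differentiable one_ne_zero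
  have eT m k ℓ x : pd m (T k ℓ) x = pd m (pd k a) x * pd ℓ a x + pd k a x * pd m (pd ℓ a) x
      + (pd m (pd k b) x * pd ℓ b x + pd k b x * pd m (pd ℓ b) x) := by
    simp only [T]
    rw [pd_add (by fun_prop) (by fun_prop), pd_mul (by fun_prop) (by fun_prop),
      pd_mul (by fun_prop) (by fun_prop)]
  have eP m ℓ x : pd m (P ℓ) x = pd m c x * pd ℓ b x + c x * pd m (pd ℓ b) x
      - (pd m d x * pd ℓ a x + d x * pd m (pd ℓ a) x) := by
    simp only [P]
    rw [pd_sub (by fun_prop) (by fun_prop), pd_mul (by fun_prop) (by fun_prop),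
      pd_mul (by fun_prop) (by fun_prop)]
  have eQ m x : pd m q x = -2 * (a x * pd m a x + b x * pd m b x) := by
    simp only [q]
    rw [pd_sub (by fun_prop) (by fun_prop), pd_add (by fun_prop) (by fun_prop),
      pd_mul (by fun_prop) (by fun_prop), pd_mul (by fun_prop) (by fun_prop), pd_const]
    ring
  have eW m x : pd m W x = 2⁻¹ * (pd m (T 0 0) x + pd m (T 1 1) x)
      + (4 * ε ^ 2)⁻¹ * (pd m ρ x * (q x * q x) + 2 * ρ x * (q x * pd m q x)) := by
    simp only [W]
    rw [pd_add (by fun_prop) (by fun_prop), pd_mul (by fun_prop) (by fun_prop),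
      pd_mul (by fun_prop) (by fun_prop), pd_add (by fun_prop) (by fun_prop),
      pd_mul (by fun_prop) (by fun_prop), pd_mul (by fun_prop) (by fun_prop), pd_const, pd_const]
    ring
  have eG₀ x : pd 0 G₀ x = pd 0 φ x * P 1 x + φ x * pd 0 (P 1) x
      - (pd 0 (pd 0 φ) x * T 0 1 x + pd 0 φ x * pd 0 (T 0 1) x
        - (pd 0 (pd 1 φ) x * T 0 0 x + pd 1 φ x * pd 0 (T 0 0) x))
      - (pd 0 (pd 1 φ) x * W x + pd 1 φ x * pd 0 W x) := by
    simp only [G₀]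
    rw [pd_sub (by fun_prop) (by fun_prop), pd_sub (by fun_prop) (by fun_prop),
      pd_sub (by fun_prop) (by fun_prop)]
    simp only [pd_mul dφ (dP _), pd_mul (dpφ _) (dT _ _), pd_mul (dpφ _) dW]
  have eG₁ x : pd 1 G₁ x = pd 1 (pd 0 φ) x * W x + pd 0 φ x * pd 1 W x
      - (pd 1 (pd 0 φ) x * T 1 1 x + pd 0 φ x * pd 1 (T 1 1) x
        - (pd 1 (pd 1 φ) x * T 1 0 x + pd 1 φ x * pd 1 (T 1 0) x))
      - (pd 1 φ x * P 0 x + φ x * pd 1 (P 0) x) := by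
    simp only [G₁]
    rw [pd_sub (by fun_prop) (by fun_prop), pd_sub (by fun_prop) (by fun_prop),
      pd_sub (by fun_prop) (by fun_prop)]
    simp only [pd_mul dφ (dP _), pd_mul (dpφ _) (dT _ _), pd_mul (dpφ _) dW]
  have key x : φ x * (pd 0 c x * pd 1 b x - pd 0 d x * pd 1 a x
        + (pd 0 a x * pd 1 d x - pd 0 b x * pd 1 c x))
      = (∑ ℓ : Fin 2, ∑ j : Fin 2, ∑ k : Fin 2,
            Jmat ℓ j * pd j (pd k φ) x * (pd k a x * pd ℓ a x + pd k b x * pd ℓ b x))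
        - (∑ ℓ : Fin 2, ∑ j : Fin 2, ∑ k : Fin 2,
            Jmat ℓ j * pd j φ x * (pd k ρ x / ρ x) * (pd ℓ a x * pd k a x + pd ℓ b x * pd k b x))
        - (∑ ℓ : Fin 2, ∑ j : Fin 2,
            Jmat ℓ j * pd j φ x * pd ℓ ρ x * (1 - (a x ^ 2 + b x ^ 2)) ^ 2 / (4 * ε ^ 2))
        + (pd 0 G₀ x + pd 1 G₁ x) := by
    have h1 : d x = -(∑ k : Fin 2, (pd k ρ x / ρ x * pd k a x + pd k (pd k a) x)
        + ρ x / ε ^ 2 * (1 - (a x ^ 2 + b x ^ 2)) * a x) := by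
      apply mul_left_cancel₀ (hρ0 x)
      rw [← neg_inj, hre x]
      have := hρ0 x
      simp only [Fin.sum_univ_two]
      field_simp
    have h2 : c x = ∑ k : Fin 2, (pd k ρ x / ρ x * pd k b x + pd k (pd k b) x)
        + ρ x / ε ^ 2 * (1 - (a x ^ 2 + b x ^ 2)) * b x := by
      apply mul_left_cancel₀ (hρ0 x)
      rw [him x]
      have := hρ0 x
      simp only [Fin.sum_univ_two]
      field_simp
    rw [eG₀, eG₁, eW, eW]
    simp only [eT, eP, eQ, pd_comm ha 1 0 x, pd_comm hb 1 0 x]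
    simp only [T, P, q, W]
    rw [h1, h2]
    simp [Jmat, Fin.sum_univ_two, pd_comm hφ 1 0 x]
    ring
  simp_rw [key]
  rw [integral_add (by exact (i1.sub i2).sub i3) (by exact iG₀.add iG₁), integral_add iG₀ iG₁,
    integral_sub (by exact i1.sub i2) i3, integral_sub i1 i2, integral_pd_eq_zero hG₀ sG₀,
    integral_pd_eq_zero hG₁ sG₁]
  ring

/-- weak form of the Jacobian evolution for the weighted
Gross–Pitaevskii equation, tested against a compactly supported `C²` function `φ`. -/
theorem jacobian_evolution_weak
    (ε : ℝ) (hε : 0 < ε) (I : Set ℝ) (hIopen : IsOpen I) (hIconn : I.OrdConnected)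
    (η : EuclideanSpace ℝ (Fin 2) → ℝ) (hη : ContDiff ℝ 2 η) (hηpos : ∀ x, 0 < η x)
    (w : EuclideanSpace ℝ (Fin 2) × ℝ → ℂ)
    (hw : ContDiffOn ℝ 3 w (Set.univ ×ˢ I))
    (hGP : ∀ x : EuclideanSpace ℝ (Fin 2), ∀ t ∈ I,
      Complex.I * ((η x : ℂ))^2 * deriv (fun s => w (x, s)) t
        = (∑ k : Fin 2, pd k (fun y => ((η y : ℂ))^2 * pd k (fun z => w (z, t)) y) x)
          + ((η x : ℂ))^4 / (ε : ℂ)^2 * ((1 : ℂ) - ((‖w (x, t)‖ : ℝ) : ℂ)^2) * w (x, t)) :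
    ∀ φ : EuclideanSpace ℝ (Fin 2) → ℝ, ContDiff ℝ 2 φ → HasCompactSupport φ →
    ∀ t ∈ I,
      ∫ x, φ x * deriv (fun s => jac (fun y => w (y, s)) x) t
        = (∫ x, ∑ ℓ : Fin 2, ∑ j : Fin 2, ∑ k : Fin 2,
              Jmat ℓ j * pd j (fun y => pd k φ y) x *
                (pd k (fun y => w (y, t)) x *
                  (starRingEnd ℂ) (pd ℓ (fun y => w (y, t)) x)).re)
          - (∫ x, ∑ ℓ : Fin 2, ∑ j : Fin 2, ∑ k : Fin 2,
              Jmat ℓ j * pd j φ x * (pd k (fun y => (η y)^2) x / (η x)^2) *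
                (pd ℓ (fun y => w (y, t)) x *
                  (starRingEnd ℂ) (pd k (fun y => w (y, t)) x)).re)
          - (∫ x, ∑ ℓ : Fin 2, ∑ j : Fin 2,
              Jmat ℓ j * pd j φ x * pd ℓ (fun y => (η y)^2) x *
                (1 - ‖w (x, t)‖^2)^2 / (4 * ε^2)) := by
  intro φ hφ hφs t ht
  have hw' {y s} (hs : s ∈ I) : ContDiffAt ℝ 3 w (y, s) :=
    hw.contDiffAt ((isOpen_univ.prod hIopen).mem_nhds ⟨trivial, hs⟩)
  have hdw {y s} (hs : s ∈ I) : ContDiffAt ℝ 2 (fderiv ℝ w) (y, s) :=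
    (hw' hs).fderiv_right (by norm_num)
  have hpd {y s} (hs : s ∈ I) (k : Fin 2) :
      pd k (fun z => w (z, s)) y = fderiv ℝ w (y, s) (EuclideanSpace.single k 1, 0) := by
    have h := HasFDerivAt.comp (f := fun e => (e, s)) y
      ((hw' hs).differentiableAt (by norm_num)).hasFDerivAt (hasFDerivAt_prodMk_left (𝕜 := ℝ) y s)
    exact congrArg (· (EuclideanSpace.single k 1)) h.fderiv
  have hline (y) : HasDerivAt (fun s : ℝ => (y, s)) ((0 : EuclideanSpace ℝ (Fin 2)), (1 : ℝ)) t :=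
    (hasDerivAt_const t y).prodMk (hasDerivAt_id t)
  have hdt (y) : deriv (fun s => w (y, s)) t = fderiv ℝ w (y, t) (0, 1) :=
    (((hw' ht).differentiableAt (by norm_num)).hasFDerivAt.comp_hasDerivAt t (hline y)).deriv
  have hu : ContDiff ℝ 3 fun y => w (y, t) := contDiff_iff_contDiffAt.2 fun y =>
    (hw' ht).comp y (contDiffAt_id.prodMk contDiffAt_const)
  have hdu : ContDiff ℝ 2 fun y => fderiv ℝ w (y, t) := contDiff_iff_contDiffAt.2 fun y =>
    (hdw ht).comp y (contDiffAt_id.prodMk contDiffAt_const)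
  set v : EuclideanSpace ℝ (Fin 2) → ℂ := fun y => fderiv ℝ w (y, t) (0, 1) with hv_def
  have hv : ContDiff ℝ 2 v := hdu.clm_apply contDiff_const
  have hpdt (x) (k : Fin 2) : HasDerivAt (fun s => pd k (fun y => w (y, s)) x) (pd k v x) t := by
    have hD := ((hdw (y := x) ht).differentiableAt (by norm_num)).hasFDerivAt
    have h1 := (hD.comp_hasDerivAt t (hline x)).clm_apply
      (hasDerivAt_const t ((EuclideanSpace.single k 1 : EuclideanSpace ℝ (Fin 2)), (0 : ℝ)))
    have h2 : pd k v x = fderiv ℝ (fderiv ℝ w) (x, t) (EuclideanSpace.single k 1, 0) (0, 1) := by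
      refine (pd_clm_comp (ContinuousLinearMap.apply ℝ ℂ
        ((0 : EuclideanSpace ℝ (Fin 2)), (1 : ℝ))) (hdu.differentiable (by norm_num) x) k).trans ?_
      have h := HasFDerivAt.comp (f := fun e => (e, t)) x hD (hasFDerivAt_prodMk_left (𝕜 := ℝ) x t)
      have h' : pd k (fun y => fderiv ℝ w (y, t)) x = _ :=
        congrArg (· (EuclideanSpace.single k 1)) h.fderiv
      rw [h']
      rfl
    rw [h2, (hw' ht).isSymmSndFDerivAt (by simp; norm_num) _ _]
    refine HasDerivAt.congr_of_eventuallyEq (by simpa using h1) ?_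
    filter_upwards [hIopen.mem_nhds ht] with s hs using hpd hs k
  have pre {f : EuclideanSpace ℝ (Fin 2) → ℂ} (hf : Differentiable ℝ f) (k x) :
      pd k (fun y => (f y).re) x = (pd k f x).re := pd_clm_comp Complex.reCLM (hf x) k
  have pim {f : EuclideanSpace ℝ (Fin 2) → ℂ} (hf : Differentiable ℝ f) (k x) :
      pd k (fun y => (f y).im) x = (pd k f x).im := pd_clm_comp Complex.imCLM (hf x) k
  set u : EuclideanSpace ℝ (Fin 2) → ℂ := fun y => w (y, t) with hu_def
  have du := hu.differentiable (by norm_num)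
  have dv := hv.differentiable (by norm_num)
  have dpu k : Differentiable ℝ (pd k u) :=
    (contDiff_pd (m := 2) (n := 3) hu (by norm_num) k).differentiable (by norm_num)
  have hρ : ContDiff ℝ 1 fun y => η y ^ 2 := (hη.of_le (by norm_num)).pow 2
  have dρ := hρ.differentiable one_ne_zero
  have pre2 k : pd k (fun y => (u y).re) = fun y => (pd k u y).re := funext (pre du k)
  have pim2 k : pd k (fun y => (u y).im) = fun y => (pd k u y).im := funext (pim du k)
  have pre3 j k x : pd j (fun y => (pd k u y).re) x = (pd j (pd k u) x).re := pre (dpu k) j x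
  have pim3 j k x : pd j (fun y => (pd k u y).im) x = (pd j (pd k u) x).im := pim (dpu k) j x
  have hprod k x : pd k (fun y => (η y : ℂ) ^ 2 * pd k u y) x =
      ((pd k (fun y => η y ^ 2) x : ℝ) : ℂ) * pd k u x + (η x : ℂ) ^ 2 * pd k (pd k u) x := by
    have h := (dρ x).hasFDerivAt.smul (dpu k x).hasFDerivAt
    have h' : (fun y => (η y : ℂ) ^ 2 * pd k u y) = (fun y => η y ^ 2) • pd k u := by
      ext y
      simp
    have h2 := congrArg (· (EuclideanSpace.single k 1)) h.fderiv
    rw [h']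
    refine h2.trans ?_
    simp [pd]
    ring
  have hnorm x : ‖w (x, t)‖ ^ 2 = (u x).re ^ 2 + (u x).im ^ 2 := by
    rw [Complex.sq_norm, Complex.normSq_apply]
    ring
  have hGP' x : Complex.I * ((η x ^ 2 : ℝ) : ℂ) * v x
      = (∑ k : Fin 2, (((pd k (fun y => η y ^ 2) x : ℝ) : ℂ) * pd k u x
          + ((η x ^ 2 : ℝ) : ℂ) * pd k (pd k u) x))
        + (((η x ^ 2) ^ 2 / ε ^ 2 * (1 - ((u x).re ^ 2 + (u x).im ^ 2)) : ℝ) : ℂ) * u x := by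
    have h := hGP x t ht
    simp only [hdt, ← hu_def, hprod] at h
    rw [← hnorm]
    push_cast
    rw [h]
    ring
  have main := jacobian_evolution_weak_real (ε := ε) (a := fun y => (u y).re)
    (b := fun y => (u y).im) (c := fun y => (v y).re) (d := fun y => (v y).im)
    (Complex.reCLM.contDiff.comp (hu.of_le (by norm_num)))
    (Complex.imCLM.contDiff.comp (hu.of_le (by norm_num)))
    (Complex.reCLM.contDiff.comp (hv.of_le (by norm_num)))
    (Complex.imCLM.contDiff.comp (hv.of_le (by norm_num)))
    hρ (fun x => pow_ne_zero 2 (hηpos x).ne') hφ hφs ?_ ?_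
  · have hJ x : deriv (fun s => jac (fun y => w (y, s)) x) t
        = (pd 0 v x).re * (pd 1 u x).im - (pd 0 v x).im * (pd 1 u x).re
          + ((pd 0 u x).re * (pd 1 v x).im - (pd 0 u x).im * (pd 1 v x).re) := by
      have h0 : HasDerivAt (fun s => (starRingEnd ℂ) (pd 0 (fun y => w (y, s)) x))
          ((starRingEnd ℂ) (pd 0 v x)) t :=
        Complex.conjCLE.toContinuousLinearMap.hasFDerivAt.comp_hasDerivAt t (hpdt x 0)
      have h := Complex.imCLM.hasFDerivAt.comp_hasDerivAt t (h0.mul (hpdt x 1))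
      refine h.deriv.trans ?_
      simp only [← hu_def, Complex.imCLM_apply, Complex.add_im, Complex.mul_im, Complex.conj_re,
        Complex.conj_im]
      ring
    have hre (z z' : ℂ) : (z * (starRingEnd ℂ) z').re = z.re * z'.re + z.im * z'.im := by
      simp [Complex.mul_re]
    simp only [pre2, pim2, pre dv, pim dv] at main
    simp only [hJ, hre, hnorm]
    exact main
  · intro x
    have h := congrArg Complex.re (hGP' x)
    simp only [pre2, pre3]
    rw [Fin.sum_univ_two] at h ⊢
    simp only [Complex.add_re, Complex.re_ofReal_mul, mul_assoc, Complex.I_mul_re,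
      Complex.im_ofReal_mul] at h ⊢
    exact h
  · intro x
    have h := congrArg Complex.im (hGP' x)
    simp only [pim2, pim3]
    rw [Fin.sum_univ_two] at h ⊢
    simp only [Complex.add_im, Complex.re_ofReal_mul, mul_assoc, Complex.I_mul_im,
      Complex.im_ofReal_mul] at h ⊢
    exact h
end

section
/- Let ε > 0, let p : ℝ² → ℝ be continuous, let η : ℝ² → ℝ be a C² function satisfying the pointwise elliptic equation Δη + (1/ε²) η (p² − η²) = 0 on ℝ², and let w : ℝ² → ℂ be C². Then at every point of ℝ², (1/2)|∇(ηw)|² + (1/(4ε²))(p² − |ηw|²)² = (1/2)|∇η|² + (1/(4ε²))(p² − η²)² + (η²/2)|∇w|² + (η⁴/(4ε²))(1 − |w|²)² + (1/2) div( (|w|² − 1) η ∇η ), where for a differentiable ℂ-valued (or ℝ-valued) function f, |∇f|² = |∂₁f|² + |∂₂f|², and div((|w|²−1)η∇η) = Σ_{k=1,2} ∂_k( (|w|²−1) η ∂_k η ). -/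
open MeasureTheory Real

/-- Laplacian `Δf = ∂₁²f + ∂₂²f` of a real-valued function on `ℝ²`. -/
noncomputable def lap (f : EuclideanSpace ℝ (Fin 2) → ℝ)
    (x : EuclideanSpace ℝ (Fin 2)) : ℝ :=
  ∑ k : Fin 2, pd k (fun y => pd k f y) x

/-- Pointwise expansion of `|∂ₖ(ηw)|²`. -/
lemma norm_sq_pd_ofReal_mul {η : EuclideanSpace ℝ (Fin 2) → ℝ} {w : EuclideanSpace ℝ (Fin 2) → ℂ}
    {x : EuclideanSpace ℝ (Fin 2)} (hη : DifferentiableAt ℝ η x) (hw : DifferentiableAt ℝ w x)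
    (k : Fin 2) :
    ‖pd k (fun y => ((η y : ℂ)) * w y) x‖^2
      = (η x)^2 * ‖pd k w x‖^2 + 2 * η x * pd k η x * inner ℝ (w x) (pd k w x)
        + (pd k η x)^2 * ‖w x‖^2 := by
  have h : pd k (fun y => ((η y : ℂ)) * w y) x = η x • pd k w x + pd k η x • w x := by
    simp only [← Complex.real_smul, pd, fderiv_fun_smul hη hw]
    simp
  rw [h, norm_add_sq_real, norm_smul, norm_smul, real_inner_smul_left, real_inner_smul_right,
    mul_pow, mul_pow, Real.norm_eq_abs, Real.norm_eq_abs, sq_abs, sq_abs, real_inner_comm]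
  ring

/-- The product rule for `∂ₖ((|w|² - 1) η g)`. -/
lemma pd_norm_sq_sub_one_mul_mul {η g : EuclideanSpace ℝ (Fin 2) → ℝ}
    {w : EuclideanSpace ℝ (Fin 2) → ℂ} {x : EuclideanSpace ℝ (Fin 2)}
    (hη : DifferentiableAt ℝ η x) (hg : DifferentiableAt ℝ g x) (hw : DifferentiableAt ℝ w x)
    (k : Fin 2) :
    pd k (fun y => (‖w y‖^2 - 1) * η y * g y) x
      = 2 * inner ℝ (w x) (pd k w x) * η x * g x
        + (‖w x‖^2 - 1) * (pd k η x * g x + η x * pd k g x) := by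
  have h := (((hw.hasFDerivAt.norm_sq).sub_const 1).fun_mul hη.hasFDerivAt).fun_mul hg.hasFDerivAt
  simp only [pd, h.fderiv]
  simp
  ring

/-- The partial derivatives of a `C²` function are differentiable. -/
lemma differentiable_pd {η : EuclideanSpace ℝ (Fin 2) → ℝ} (hη : ContDiff ℝ 2 η) (k : Fin 2) :
    Differentiable ℝ (pd k η) :=
  ((hη.fderiv_right (m := 1) (by norm_num)).clm_apply contDiff_const).differentiable (by norm_num)

/-- the Lassoued–Mironescu energy-splitting identity.  If
`Δη + (1/ε²) η (p² − η²) = 0`, then pointwise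
`e_ε(ηw) = e_ε(η) + e^η_ε(w) + (1/2) div((|w|² − 1) η ∇η)`. -/
theorem lassoued_mironescu_splitting
    (ε : ℝ) (hε : 0 < ε)
    (p : EuclideanSpace ℝ (Fin 2) → ℝ) (hp : Continuous p)
    (η : EuclideanSpace ℝ (Fin 2) → ℝ) (hη : ContDiff ℝ 2 η)
    (hTF : ∀ x, lap η x + (1 / ε^2) * η x * ((p x)^2 - (η x)^2) = 0)
    (w : EuclideanSpace ℝ (Fin 2) → ℂ) (hw : ContDiff ℝ 2 w) :
    ∀ x : EuclideanSpace ℝ (Fin 2),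
      (1 / 2) * (∑ k : Fin 2, ‖pd k (fun y => ((η y : ℂ)) * w y) x‖^2)
          + (1 / (4 * ε^2)) * ((p x)^2 - ‖((η x : ℂ)) * w x‖^2)^2
        = (1 / 2) * (∑ k : Fin 2, (pd k η x)^2)
            + (1 / (4 * ε^2)) * ((p x)^2 - (η x)^2)^2
          + (η x)^2 / 2 * (∑ k : Fin 2, ‖pd k w x‖^2)
            + (η x)^4 / (4 * ε^2) * (1 - ‖w x‖^2)^2
          + (1 / 2) * ∑ k : Fin 2,
              pd k (fun y => (‖w y‖^2 - 1) * η y * pd k η y) x := by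
  intro x
  have hηx : DifferentiableAt ℝ η x := hη.differentiable (by norm_num) x
  have hwx : DifferentiableAt ℝ w x := hw.differentiable (by norm_num) x
  have hT := hTF x
  simp only [lap, Fin.sum_univ_two] at hT
  have hnorm : ‖((η x : ℂ)) * w x‖^2 = (η x)^2 * ‖w x‖^2 := by
    rw [norm_mul, mul_pow, Complex.norm_real, Real.norm_eq_abs, sq_abs]
  simp only [Fin.sum_univ_two, norm_sq_pd_ofReal_mul hηx hwx, hnorm,
    pd_norm_sq_sub_one_mul_mul hηx (differentiable_pd hη _ x) hwx]
  linear_combination (-(1 / 2) * (‖w x‖^2 - 1) * η x) * hT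
end

section
/- Let ε > 0, let η : ℝ² → ℝ, let w, w* : ℝ² → ℂ be differentiable at a point x ∈ ℝ², suppose w(x) ≠ 0, and suppose |w*| = 1 on a neighborhood of x. Then at x, (η²/2) | j(w)/|w| − j(w*) |² + (η²/2) |∇|w||² + (η⁴/(4ε²))(1 − |w|²)² = e^η_ε(w) − e^η_ε(w*) + η² j(w*) · ( j(w*) − j(w)/|w| ), where |∇|w||² is the squared Euclidean norm of the gradient of the function x ↦ |w(x)|, and · denotes the Euclidean inner product of vector fields on ℝ². -/
open MeasureTheory Real

/-- Supercurrent `j(w)_k = Im(conj w ∂_k w)`. -/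
noncomputable def scur (w : EuclideanSpace ℝ (Fin 2) → ℂ) (k : Fin 2)
    (x : EuclideanSpace ℝ (Fin 2)) : ℝ :=
  ((starRingEnd ℂ) (w x) * pd k w x).im

/-- The derivative of the modulus: `|w| ∂_k |w| = Re (conj w ∂_k w)`. -/
theorem norm_mul_pd_norm {w : EuclideanSpace ℝ (Fin 2) → ℂ} {x : EuclideanSpace ℝ (Fin 2)}
    (hw : DifferentiableAt ℝ w x) (hwx : w x ≠ 0) (k : Fin 2) :
    ‖w x‖ * pd k (fun y => ‖w y‖) x = ((starRingEnd ℂ) (w x) * pd k w x).re := by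
  have h_sq := hw.hasFDerivAt.norm_sq
  have h_pow := (hw.norm ℝ hwx).hasFDerivAt.pow 2
  have h := congrArg (fun L => L (EuclideanSpace.single k 1)) (h_sq.unique h_pow)
  simp [Complex.inner] at h
  simp only [pd, Complex.mul_re, Complex.conj_re, Complex.conj_im]
  linarith

/-- Splitting of a partial derivative into its radial and tangential parts. -/
theorem norm_pd_sq {w : EuclideanSpace ℝ (Fin 2) → ℂ} {x : EuclideanSpace ℝ (Fin 2)}
    (hw : DifferentiableAt ℝ w x) (hwx : w x ≠ 0) (k : Fin 2) :
    ‖pd k w x‖ ^ 2 = pd k (fun y => ‖w y‖) x ^ 2 + (scur w k x / ‖w x‖) ^ 2 := by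
  have h_pos : ‖w x‖ ≠ 0 := norm_ne_zero_iff.mpr hwx
  have h_norm : (‖w x‖ * ‖pd k w x‖) ^ 2
      = (‖w x‖ * pd k (fun y => ‖w y‖) x) ^ 2 + scur w k x ^ 2 := by
    rw [norm_mul_pd_norm hw hwx, scur, ← Complex.norm_conj (w x), ← norm_mul, Complex.sq_norm,
      Complex.normSq_apply]
    ring
  field_simp
  linarith

/-- the pointwise energy-splitting identity
`(η²/2)|j(w)/|w| − j(w*)|² + (η²/2)|∇|w||² + (η⁴/4ε²)(1−|w|²)²
  = e^η_ε(w) − e^η_ε(w*) + η² j(w*)·(j(w*) − j(w)/|w|)`,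
valid at a point where `w ≠ 0` and `|w*| = 1` near the point. -/
theorem energy_splitting_identity
    (ε : ℝ) (hε : 0 < ε)
    (η : EuclideanSpace ℝ (Fin 2) → ℝ)
    (w ws : EuclideanSpace ℝ (Fin 2) → ℂ)
    (x : EuclideanSpace ℝ (Fin 2))
    (hw : DifferentiableAt ℝ w x) (hws : DifferentiableAt ℝ ws x)
    (hwx : w x ≠ 0) (hmod : ∀ᶠ y in nhds x, ‖ws y‖ = 1) :
    (η x)^2 / 2 * (∑ k : Fin 2, (scur w k x / ‖w x‖ - scur ws k x)^2)
      + (η x)^2 / 2 * (∑ k : Fin 2, (pd k (fun y => ‖w y‖) x)^2)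
      + (η x)^4 / (4 * ε^2) * (1 - ‖w x‖^2)^2
    = eden ε η w x - eden ε η ws x
      + (η x)^2 * ∑ k : Fin 2, scur ws k x * (scur ws k x - scur w k x / ‖w x‖) := by
  have h_one : ‖ws x‖ = 1 := hmod.self_of_nhds
  have h_ne : ws x ≠ 0 := norm_ne_zero_iff.mp (by rw [h_one]; exact one_ne_zero)
  have h_grad (k : Fin 2) : pd k (fun y => ‖ws y‖) x = 0 := by
    have h_const : (fun y => ‖ws y‖) =ᶠ[nhds x] fun _ => (1 : ℝ) := hmod
    simp [pd, h_const.fderiv_eq]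
  simp only [eden, Fin.sum_univ_two, norm_pd_sq hw hwx, norm_pd_sq hws h_ne, h_grad, h_one]
  ring
end
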